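/- arXiv:1603.04266 — 3 statements merged into one kernel-verified Lean document; each statement's English description precedes it below -/
import Mathlib

section
/- Let T be a tree of finite radius. Then η(T) equals the radius of T, i.e., the capture-time ordinal η(T) coincides with min over vertices v of the eccentricity of v. -/
universe u

open Ordinal

open Classical in
/-- The Nowakowski–Winkler relations `≤_α`: `u ≤_0 v` iff `u = v`; for `α > 0`,
`u ≤_α v` iff every `x ∈ N[u]` has some `y ∈ N[v]` with `x ≤_β y` for some `β < α`. -/
noncomputable def crRel {V : Type u} (G : SimpleGraph V) (α : Ordinal.{u}) (a b : V) : Prop :=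
  if α = 0 then a = b
  else ∀ x ∈ insert a (G.neighborSet a), ∃ y ∈ insert b (G.neighborSet b),
    ∃ β : Ordinal.{u}, ∃ _ : β < α, crRel G β x y
termination_by α
decreasing_by assumption

/-- The CR-ordinal `ρ(G)`: the least ordinal where the tower `≤_α` stabilizes. -/
noncomputable def CRord {V : Type u} (G : SimpleGraph V) : Ordinal.{u} :=
  sInf {ρ : Ordinal.{u} | crRel G ρ = crRel G (ρ + 1)}

/-- `G` is cop-win when the stabilized relation is trivial. -/
def CopWin {V : Type u} (G : SimpleGraph V) : Prop :=
  ∀ a b : V, crRel G (CRord G) a b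

/-- `η(u, v)`: least `α` with `u ≤_α v`. -/
noncomputable def etaPair {V : Type u} (G : SimpleGraph V) (a b : V) : Ordinal.{u} :=
  sInf {α : Ordinal.{u} | crRel G α a b}

/-- `η(v) = sup_u η(u, v)`. -/
noncomputable def etaVert {V : Type u} (G : SimpleGraph V) (b : V) : Ordinal.{u} :=
  ⨆ a : V, etaPair G a b

/-- `η(G) = min_v η(v)`. -/
noncomputable def etaG {V : Type u} (G : SimpleGraph V) : Ordinal.{u} :=
  ⨅ b : V, etaVert G b

/-- `θ(G)`: the vertices realizing `η(G)`. -/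
def theta {V : Type u} (G : SimpleGraph V) : Set V :=
  {b | etaVert G b = etaG G}

/-- Eccentricity of a vertex, as an extended natural number. -/
noncomputable def ecc {V : Type u} (G : SimpleGraph V) (v : V) : ℕ∞ :=
  ⨆ u : V, G.edist v u

/-- Radius: minimum eccentricity. -/
noncomputable def radius {V : Type u} (G : SimpleGraph V) : ℕ∞ :=
  ⨅ v : V, ecc G v

/-- Diameter: supremum of distances. -/
noncomputable def diam {V : Type u} (G : SimpleGraph V) : ℕ∞ :=
  ⨆ u : V, ⨆ v : V, G.edist u v

theorem crRel_zero {V : Type u} (G : SimpleGraph V) (a b : V) : crRel G 0 a b ↔ a = b := by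
  rw [crRel, if_pos rfl]

theorem crRel_natCast_succ {V : Type u} (G : SimpleGraph V) (n : ℕ) (a b : V) :
    crRel G ((n + 1 : ℕ) : Ordinal.{u}) a b ↔
      ∀ x ∈ insert a (G.neighborSet a), ∃ y ∈ insert b (G.neighborSet b),
        ∃ m ≤ n, crRel G (m : Ordinal.{u}) x y := by
  rw [crRel, if_neg (by exact_mod_cast Nat.succ_ne_zero n)]
  refine forall₂_congr fun x _ => exists_congr fun y => and_congr_right fun _ => ?_
  constructor
  · rintro ⟨β, hβ, h⟩
    obtain ⟨m, rfl⟩ := lt_omega0.1 (hβ.trans (natCast_lt_omega0 _))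
    exact ⟨m, Nat.lt_succ_iff.1 (by exact_mod_cast hβ), h⟩
  · rintro ⟨m, hm, h⟩
    exact ⟨m, by exact_mod_cast Nat.lt_succ_iff.2 hm, h⟩

/-- A cop starting at `b` needs at least as many moves as the distance to a robber
sitting still at `a`. -/
theorem edist_le_of_crRel_natCast {V : Type u} (G : SimpleGraph V) (n : ℕ) :
    ∀ a b : V, crRel G (n : Ordinal.{u}) a b → G.edist b a ≤ n := by
  induction n using Nat.strong_induction_on with
  | _ n ih =>
    intro a b h
    cases n with
    | zero =>
      rw [Nat.cast_zero, crRel_zero] at h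
      simp [h]
    | succ n =>
      obtain ⟨y, hy, m, hm, h⟩ := (crRel_natCast_succ G n a b).1 h a (Set.mem_insert _ _)
      have hy : G.edist b y ≤ 1 := by
        rw [SimpleGraph.edist_le_one_iff_adj_or_eq]
        rcases hy with rfl | hy
        · exact Or.inr rfl
        · exact Or.inl hy
      calc G.edist b a ≤ G.edist b y + G.edist y a := SimpleGraph.edist_triangle
        _ ≤ 1 + m := add_le_add hy (ih m (by omega) a y h)
        _ ≤ 1 + n := by gcongr
        _ = (n + 1 : ℕ) := by push_cast; exact add_comm _ _

/-- Removing an edge `vy` of a tree separates the vertices closer to `y` from those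
closer to `v`. -/
theorem SimpleGraph.IsTree.dist_eq_of_separated {V : Type u} {T : SimpleGraph V}
    (hT : T.IsTree) {v y x w : V} (hadj : T.Adj y v) (hx : T.dist x y < T.dist x v)
    (hw : T.dist v w < T.dist y w) : T.dist x w = T.dist x y + 1 + T.dist v w := by
  classical
  have split : ∀ {s t z : V} (p : T.Walk s t), p.length = T.dist s t → z ∈ p.support →
      T.dist s z + T.dist z t ≤ T.dist s t := by
    intro s t z p hp hz
    have h := congrArg SimpleGraph.Walk.length (p.take_spec hz)
    rw [SimpleGraph.Walk.length_append] at h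
    have h₁ := SimpleGraph.dist_le (p.takeUntil z hz)
    have h₂ := SimpleGraph.dist_le (p.dropUntil z hz)
    omega
  obtain ⟨p, hp, hpl⟩ := hT.connected.exists_path_of_dist x y
  obtain ⟨q, hq, hql⟩ := hT.connected.exists_path_of_dist v w
  obtain ⟨s, hs, hsl⟩ := hT.connected.exists_path_of_dist x w
  have hpath : (p.append (SimpleGraph.Walk.cons hadj q)).IsPath := by
    rw [SimpleGraph.Walk.isPath_def, SimpleGraph.Walk.support_append,
      SimpleGraph.Walk.support_cons, List.tail_cons, List.nodup_append']
    refine ⟨hp.support_nodup, hq.support_nodup, fun z hzp hzq => ?_⟩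
    have h₁ := split p hpl hzp
    have h₂ := split q hql hzq
    have h₃ := hT.connected.dist_triangle (u := x) (v := z) (w := v)
    have h₄ := hT.connected.dist_triangle (u := y) (v := z) (w := w)
    rw [SimpleGraph.dist_comm (u := v) (v := z)] at h₂
    rw [SimpleGraph.dist_comm (u := y) (v := z)] at h₄
    omega
  have h := congrArg SimpleGraph.Walk.length ((hT.existsUnique_path x w).unique hs hpath)
  rw [SimpleGraph.Walk.length_append, SimpleGraph.Walk.length_cons] at h
  omega

/-- A cop at `v` catches a robber at `u` within `n` moves if every vertex of the branch at `v`
containing `u` is at distance at most `n` from `v`. -/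
theorem SimpleGraph.IsTree.crRel_natCast {V : Type u} {T : SimpleGraph V} (hT : T.IsTree)
    (n : ℕ) : ∀ u v : V,
      (∀ w, T.dist u w < T.dist u v + T.dist v w → T.dist v w ≤ n) →
        ∃ m ≤ n, crRel T (m : Ordinal.{u}) u v := by
  induction n with
  | zero =>
    intro u v h
    refine ⟨0, le_rfl, ?_⟩
    rw [Nat.cast_zero, crRel_zero]
    by_contra hne
    have hpos := hT.connected.pos_dist_of_ne hne
    have := h u (by rw [SimpleGraph.dist_self]; omega)
    rw [SimpleGraph.dist_comm] at this
    omega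
  | succ n ih =>
    intro u v h
    by_cases huv : u = v
    · exact ⟨0, Nat.zero_le _, by rw [Nat.cast_zero, crRel_zero]; exact huv⟩
    refine ⟨n + 1, le_rfl, (crRel_natCast_succ T n u v).2 fun x hx => ?_⟩
    by_cases hxv : x = v
    · exact ⟨v, Set.mem_insert _ _, 0, Nat.zero_le _, by
        rw [Nat.cast_zero, crRel_zero]; exact hxv⟩
    obtain ⟨p, hp⟩ := hT.connected.exists_walk_length_eq_dist v x
    cases p with
    | nil => exact absurd rfl hxv
    | @cons _ y _ hvy q =>
      rw [SimpleGraph.Walk.length_cons] at hp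
      have hyx : T.dist x y < T.dist x v := by
        have := SimpleGraph.dist_le q
        rw [SimpleGraph.dist_comm (u := x), SimpleGraph.dist_comm (u := x)]
        omega
      refine ⟨y, Set.mem_insert_of_mem _ hvy, ih x y fun w hw => ?_⟩
      have huy : T.dist u y < T.dist u v := by
        rcases hT.dist_eq_dist_add_one_of_adj u hvy with h' | h'
        · omega
        · have hsep := hT.dist_eq_of_separated (w := u) hvy.symm hyx (by
            rw [SimpleGraph.dist_comm (v := u), SimpleGraph.dist_comm (v := u)]; omega)
          have hxu : T.dist x u ≤ 1 := by
            rcases hx with rfl | hx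
            · simp
            · exact (SimpleGraph.dist_eq_one_iff_adj.2 (SimpleGraph.Adj.symm hx)).le
          have := hT.connected.pos_dist_of_ne (Ne.symm huv)
          omega
      have h₁ := hT.connected.dist_triangle (u := u) (v := y) (w := w)
      have hside := hT.dist_eq_dist_add_one_of_adj w hvy
      rw [SimpleGraph.dist_comm (u := w), SimpleGraph.dist_comm (u := w)] at hside
      rcases hside with h' | h'
      · have := h w (by omega)
        omega
      · have := hT.dist_eq_of_separated hvy.symm hyx (w := w) (by omega)
        omega

theorem SimpleGraph.IsTree.crRel_of_ecc_le {V : Type u} {T : SimpleGraph V} (hT : T.IsTree)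
    {n : ℕ} {v : V} (h : ecc T v ≤ n) (u : V) : ∃ m ≤ n, crRel T (m : Ordinal.{u}) u v :=
  hT.crRel_natCast n u v fun w _ => by
    have hw : T.edist v w ≤ n := (le_iSup (fun u => T.edist v u) w).trans h
    rw [← (hT.connected v w).coe_dist_eq_edist] at hw
    exact_mod_cast hw

theorem SimpleGraph.IsTree.etaPair_le {V : Type u} {T : SimpleGraph V} (hT : T.IsTree)
    {n : ℕ} {v : V} (h : ecc T v ≤ n) (u : V) : etaPair T u v ≤ n := by
  obtain ⟨m, hm, hr⟩ := hT.crRel_of_ecc_le h u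
  exact (csInf_le' (s := {α | crRel T α u v}) hr).trans (by exact_mod_cast hm)

theorem ecc_ne_top {V : Type u} {G : SimpleGraph V} (hG : G.Connected) {c : V}
    (hc : ecc G c ≠ ⊤) (v : V) : ecc G v ≠ ⊤ := by
  have hvc : G.edist v c ≠ ⊤ := SimpleGraph.edist_ne_top_iff_reachable.2 (hG v c)
  refine ne_top_of_le_ne_top (WithTop.add_ne_top.2 ⟨hvc, hc⟩) (iSup_le fun u => ?_)
  exact SimpleGraph.edist_triangle.trans
    (add_le_add le_rfl (le_iSup (fun u => G.edist c u) u))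

theorem SimpleGraph.IsTree.etaVert_eq {V : Type u} {T : SimpleGraph V} (hT : T.IsTree)
    {n : ℕ} {v : V} (h : ecc T v = n) : etaVert T v = n := by
  have hle : etaVert T v ≤ n := Ordinal.iSup_le fun u => hT.etaPair_le h.le u
  obtain ⟨m, hm⟩ := lt_omega0.1 (hle.trans_lt (natCast_lt_omega0 n))
  have hecc : ecc T v ≤ m := by
    refine iSup_le fun u => ?_
    have hmem : crRel T (etaPair T u v) u v := by
      obtain ⟨k, -, hk⟩ := hT.crRel_of_ecc_le h.le u
      exact csInf_mem (s := {α | crRel T α u v}) ⟨_, hk⟩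
    have hum : etaPair T u v ≤ m := hm ▸ Ordinal.le_iSup (fun u => etaPair T u v) u
    obtain ⟨k, hk⟩ := lt_omega0.1 (hum.trans_lt (natCast_lt_omega0 m))
    rw [hk] at hmem hum
    exact (edist_le_of_crRel_natCast T k u v hmem).trans (by exact_mod_cast hum)
  refine le_antisymm hle ?_
  rw [h] at hecc
  rw [hm]
  exact_mod_cast hecc

/-- In a tree of finite radius, the capture-time ordinal `η(T)` equals the radius. -/
theorem etaG_eq_radius_of_finite_radius {V : Type u} (T : SimpleGraph V)
    (hT : T.IsTree) (hfin : radius T ≠ ⊤) :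
    ∃ r : ℕ, radius T = (r : ℕ∞) ∧ etaG T = (r : Ordinal.{u}) := by
  have : Nonempty V := hT.connected.nonempty
  obtain ⟨r, hr⟩ := ENat.ne_top_iff_exists.1 hfin
  obtain ⟨c, hc⟩ := ENat.exists_eq_iInf (ecc T)
  have hcr : ecc T c = r := hc.trans hr.symm
  refine ⟨r, hr.symm, le_antisymm ?_ (le_ciInf fun v => ?_)⟩
  · exact (ciInf_le' _ c).trans (hT.etaVert_eq hcr).le
  · obtain ⟨n, hn⟩ := ENat.ne_top_iff_exists.1
      (ecc_ne_top hT.connected (hcr ▸ ENat.natCast_ne_top r) v)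
    rw [hT.etaVert_eq hn.symm]
    have hrn : (r : ℕ∞) ≤ n := hr ▸ hn ▸ iInf_le (ecc T) v
    exact_mod_cast hrn
end

section
/- Let T be a cop-win tree of infinite radius. Then for every vertex v ∈ V(T) \ θ(T), one has η(v) = η(T) + d(v, θ(T)), where d(v, θ(T)) is the minimum distance from v to a vertex in θ(T). -/
universe u

open Ordinal

/-- `d(v, S)`: minimum graph distance from a vertex to a set of vertices. -/
noncomputable def distToSet {V : Type u} (G : SimpleGraph V) (v : V) (S : Set V) : ℕ :=
  sInf {n : ℕ | ∃ s ∈ S, G.dist v s = n}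

namespace SimpleGraph

variable {V : Type u} {G : SimpleGraph V}

theorem crRel_zero_iff {a b : V} : crRel G 0 a b ↔ a = b := by
  rw [crRel]
  simp

theorem crRel_iff_of_ne_zero {α : Ordinal.{u}} (hα : α ≠ 0) {a b : V} :
    crRel G α a b ↔ ∀ x ∈ insert a (G.neighborSet a), ∃ y ∈ insert b (G.neighborSet b),
      ∃ β < α, crRel G β x y := by
  rw [crRel]
  simp [hα]

theorem crRel_refl (α : Ordinal.{u}) (a : V) : crRel G α a a := by
  rcases eq_or_ne α 0 with rfl | hα
  · exact crRel_zero_iff.2 rfl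
  · exact (crRel_iff_of_ne_zero hα).2 fun x hx =>
      ⟨x, hx, 0, pos_iff_ne_zero.2 hα, crRel_zero_iff.2 rfl⟩

theorem crRel_mono {α β : Ordinal.{u}} (hαβ : α ≤ β) {a b : V} (h : crRel G α a b) :
    crRel G β a b := by
  rcases eq_or_ne α 0 with rfl | hα
  · obtain rfl := crRel_zero_iff.1 h
    exact crRel_refl β a
  · have hβ : β ≠ 0 := ((pos_iff_ne_zero.2 hα).trans_le hαβ).ne'
    refine (crRel_iff_of_ne_zero hβ).2 fun x hx => ?_
    obtain ⟨y, hy, δ, hδ, hxy⟩ := (crRel_iff_of_ne_zero hα).1 h x hx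
    exact ⟨y, hy, δ, hδ.trans_le hαβ, hxy⟩

/-- If `w` lies on every walk from `a` to `b`, and `w ≠ a`, then it lies on every walk from a vertex
of the closed neighbourhood of `a` to `b`. -/
theorem mem_support_of_mem_closedNeighbor {w a a' b : V}
    (hw : ∀ p : G.Walk a b, w ∈ p.support) (hwa : w ≠ a) (ha' : a' ∈ insert a (G.neighborSet a))
    (p : G.Walk a' b) : w ∈ p.support := by
  rcases ha' with rfl | hadj
  · exact hw p
  · have := hw (.cons (show G.Adj a a' from hadj) p)
    rw [Walk.support_cons, List.mem_cons] at this
    exact this.resolve_left hwa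

theorem forall_mem_support_symm {w a b : V} (hw : ∀ p : G.Walk a b, w ∈ p.support)
    (p : G.Walk b a) : w ∈ p.support := by
  simpa using hw p.reverse

/-- A cop standing on a vertex that separates it from the robber does at least as well. -/
theorem crRel_of_separates {α : Ordinal.{u}} {w a b : V}
    (hw : ∀ p : G.Walk b a, w ∈ p.support) (h : crRel G α a b) : crRel G α a w := by
  induction α using WellFoundedLT.induction generalizing a b with
  | ind α ih =>
    rcases eq_or_ne w a with rfl | hwa
    · exact crRel_refl α w
    rcases eq_or_ne w b with rfl | hwb
    · exact h
    rcases eq_or_ne α 0 with rfl | hα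
    · obtain rfl := crRel_zero_iff.1 h
      simpa [hwa] using hw .nil
    refine (crRel_iff_of_ne_zero hα).2 fun x hx => ?_
    obtain ⟨y, hy, β, hβ, hxy⟩ := (crRel_iff_of_ne_zero hα).1 h x hx
    refine ⟨w, Set.mem_insert _ _, β, hβ, ih β hβ ?_ hxy⟩
    refine forall_mem_support_symm (mem_support_of_mem_closedNeighbor ?_ hwa hx)
    exact forall_mem_support_symm (mem_support_of_mem_closedNeighbor hw hwb hy)

theorem etaVert_le_iff (hwin : CopWin G) {v : V} {γ : Ordinal.{u}} :
    etaVert G v ≤ γ ↔ ∀ a, crRel G γ a v := by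
  rw [etaVert, Ordinal.iSup_le_iff]
  refine forall_congr' fun a => ⟨fun h => ?_, fun h => csInf_le' h⟩
  exact crRel_mono h (csInf_mem (s := {α | crRel G α a v}) ⟨_, hwin a v⟩)

theorem etaVert_le_add_one_of_adj (hwin : CopWin G) {v w : V} (hvw : G.Adj v w)
    {γ : Ordinal.{u}} (hw : etaVert G w ≤ γ) : etaVert G v ≤ γ + 1 := by
  rw [etaVert_le_iff hwin] at hw ⊢
  exact fun a => (crRel_iff_of_ne_zero (by simp)).2 fun x _ =>
    ⟨w, Or.inr hvw, γ, lt_add_one γ, hw x⟩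

theorem etaVert_le_add_length (hwin : CopWin G) {v t : V} (p : G.Walk v t) :
    etaVert G v ≤ etaVert G t + (p.length : Ordinal.{u}) := by
  induction p with
  | nil => simp
  | cons h p ih =>
    have := etaVert_le_add_one_of_adj hwin h ih
    simpa [add_assoc] using this

/-- In a tree, the neighbour of `v` in the direction of `t` lies on every walk from `v` to `t`. -/
theorem IsTree.exists_adj_separates (hG : G.IsTree) {v t : V} (hvt : v ≠ t) :
    ∃ w, G.Adj v w ∧ ∀ p : G.Walk v t, w ∈ p.support := by
  classical
  obtain ⟨q, hq⟩ := (hG.existsUnique_path v t).exists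
  refine ⟨q.snd, q.adj_snd (Walk.not_nil_of_ne hvt), fun p => ?_⟩
  have hpq : p.bypass = q := (hG.existsUnique_path v t).unique p.bypass_isPath hq
  exact p.support_bypass_subset_support (hpq ▸ q.getVert_mem_support 1)

theorem IsTree.exists_adj_etaVert_le (hG : G.IsTree) (hwin : CopWin G) {v t : V} (hvt : v ≠ t)
    {γ : Ordinal.{u}} (hv : etaVert G v ≤ γ + 1) (ht : etaVert G t ≤ γ) :
    ∃ w, G.Adj v w ∧ etaVert G w ≤ γ := by
  obtain ⟨w, hvw, hw⟩ := hG.exists_adj_separates hvt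
  refine ⟨w, hvw, ?_⟩
  rw [etaVert_le_iff hwin] at hv ht ⊢
  intro a
  by_cases hta : ∀ p : G.Walk t a, w ∈ p.support
  · exact crRel_of_separates hta (ht a)
  · obtain ⟨p, hp⟩ := not_forall.1 hta
    have hva (q : G.Walk v a) : w ∈ q.support := by
      have := hw (q.append p.reverse)
      rw [Walk.mem_support_append_iff, Walk.support_reverse, List.mem_reverse] at this
      exact this.resolve_right hp
    obtain ⟨y, hy, β, hβ, hay⟩ :=
      (crRel_iff_of_ne_zero (by simp)).1 (hv a) a (Set.mem_insert _ _)
    exact crRel_mono (Order.lt_add_one_iff.1 hβ)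
      (crRel_of_separates (mem_support_of_mem_closedNeighbor hva hvw.ne' hy) hay)

theorem etaG_le_etaVert (v : V) : etaG G ≤ etaVert G v :=
  ciInf_le' _ v

theorem theta_nonempty [Nonempty V] : (theta G).Nonempty :=
  ciInf_mem (etaVert G)

theorem IsTree.exists_mem_theta_dist_le (hG : G.IsTree) (hwin : CopWin G) (m : ℕ) {v : V}
    (hv : etaVert G v ≤ etaG G + (m : Ordinal.{u})) : ∃ s ∈ theta G, G.dist v s ≤ m := by
  induction m generalizing v with
  | zero => exact ⟨v, le_antisymm (by simpa using hv) (etaG_le_etaVert v), by simp⟩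
  | succ m ih =>
    by_cases hvθ : v ∈ theta G
    · exact ⟨v, hvθ, by simp⟩
    have : Nonempty V := ⟨v⟩
    obtain ⟨t, ht⟩ := theta_nonempty (G := G)
    obtain ⟨w, hvw, hw⟩ := hG.exists_adj_etaVert_le hwin (γ := etaG G + (m : Ordinal.{u}))
      (ne_of_mem_of_not_mem ht hvθ).symm (by simpa [add_assoc] using hv)
      ((show etaVert G t = etaG G from ht).le.trans le_self_add)
    obtain ⟨s, hs, hws⟩ := ih hw
    refine ⟨s, hs, ?_⟩
    have := hG.connected.dist_triangle (u := v) (v := w) (w := s)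
    rw [dist_eq_one_iff_adj.2 hvw] at this
    lia

end SimpleGraph

/-- For a cop-win tree of infinite radius and any vertex `v ∉ θ(T)`,
`η(v) = η(T) + d(v, θ(T))`. -/
theorem etaVert_eq_etaG_add_dist {V : Type u} (T : SimpleGraph V)
    (hT : T.IsTree) (hwin : CopWin T) (hrad : radius T = ⊤) :
    ∀ v : V, v ∉ theta T →
      etaVert T v = etaG T + ((distToSet T v (theta T) : ℕ) : Ordinal.{u}) := by
  intro v _
  have : Nonempty V := ⟨v⟩
  obtain ⟨s₀, hs₀⟩ := SimpleGraph.theta_nonempty (G := T)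
  obtain ⟨s, hs, hvs⟩ : ∃ s ∈ theta T, T.dist v s = distToSet T v (theta T) :=
    Nat.sInf_mem (s := {n | ∃ s ∈ theta T, T.dist v s = n}) ⟨_, s₀, hs₀, rfl⟩
  obtain ⟨p, hp⟩ := hT.connected.exists_walk_length_eq_dist v s
  have hle := SimpleGraph.etaVert_le_add_length hwin p
  rw [hp, hvs, show etaVert T s = etaG T from hs] at hle
  refine hle.antisymm ?_
  obtain ⟨δ, hδ⟩ := exists_add_of_le (SimpleGraph.etaG_le_etaVert (G := T) v)
  rw [hδ, add_le_add_iff_left] at hle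
  obtain ⟨m, rfl⟩ := Ordinal.lt_omega0.1 (hle.trans_lt (Ordinal.natCast_lt_omega0 _))
  obtain ⟨t, ht, hvt⟩ := hT.exists_mem_theta_dist_le hwin m hδ.le
  rw [hδ, add_le_add_iff_left, Nat.cast_le]
  exact (Nat.sInf_le ⟨t, ht, rfl⟩ : distToSet T v (theta T) ≤ T.dist v t).trans hvt
end

section
/- For n ≥ 2, the path P_n on n vertices satisfies η(P_n) = ⌈(n−1)/2⌉ and ρ(P_n) = n − 1; in particular every finite ordinal is the CR-ordinal of a finite path. -/
universe u

open Ordinal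

/-- The value of `η(a, b)` on the path with `n` vertices. -/
def pathEta (n : ℕ) (a b : Fin n) : ℕ :=
  if a = b then 0 else if a < b then b else n - 1 - b

theorem exists_pathEta_lt {n : ℕ} {a b x : Fin n}
    (hx : x = a ∨ (SimpleGraph.pathGraph n).Adj a x) :
    ∃ y, (y = b ∨ (SimpleGraph.pathGraph n).Adj b y) ∧
      pathEta n x y < max (pathEta n a b) 1 := by
  simp only [SimpleGraph.pathGraph_adj, Fin.ext_iff, pathEta, Fin.lt_def] at *
  by_cases hxb : x.val = b.val
  · exact ⟨b, by omega, by split_ifs <;> omega⟩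
  by_cases hxb' : x.val < b.val
  · exact ⟨⟨b - 1, by omega⟩, by simp only; omega, by simp only; split_ifs <;> omega⟩
  · exact ⟨⟨b + 1, by omega⟩, .inr (.inl rfl), by simp only; split_ifs <;> omega⟩

theorem exists_forall_pathEta_le {n : ℕ} (a b : Fin n) :
    ∃ x, (x = a ∨ (SimpleGraph.pathGraph n).Adj a x) ∧
      ∀ y, (y = b ∨ (SimpleGraph.pathGraph n).Adj b y) →
        pathEta n a b ≤ pathEta n x y + 1 := by
  simp only [SimpleGraph.pathGraph_adj, Fin.ext_iff, pathEta, Fin.lt_def]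
  by_cases hab : a.val < b.val
  · refine ⟨⟨a - 1, by omega⟩, by simp only; omega, fun y hy => ?_⟩
    simp only
    split_ifs <;> omega
  · by_cases ha : a.val + 1 < n
    · refine ⟨⟨a + 1, ha⟩, .inr (.inl rfl), fun y hy => ?_⟩
      simp only
      split_ifs <;> omega
    · refine ⟨a, by omega, fun y hy => ?_⟩
      split_ifs <;> omega

theorem crRel_pathGraph_iff {n : ℕ} (α : Ordinal.{0}) (a b : Fin n) :
    crRel (SimpleGraph.pathGraph n) α a b ↔ (pathEta n a b : Ordinal.{0}) ≤ α := by
  induction α using WellFoundedLT.induction generalizing a b with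
  | ind α ih =>
    rw [crRel]
    split_ifs with hα
    · subst hα
      rw [nonpos_iff_eq_zero, Nat.cast_eq_zero]
      simp only [pathEta, Fin.ext_iff, Fin.lt_def]
      split_ifs <;> omega
    · simp only [Set.mem_insert_iff, SimpleGraph.mem_neighborSet]
      constructor
      · intro h
        obtain ⟨x, hx, hle⟩ := exists_forall_pathEta_le a b
        obtain ⟨y, hy, β, hβ, hxy⟩ := h x hx
        rw [ih β hβ] at hxy
        calc (pathEta n a b : Ordinal.{0}) ≤ ((pathEta n x y + 1 : ℕ) : Ordinal.{0}) := by
              exact_mod_cast hle y hy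
          _ = Order.succ (pathEta n x y : Ordinal.{0}) := by
              rw [Nat.cast_add, Nat.cast_one, Order.succ_eq_add_one]
          _ ≤ α := Order.succ_le_of_lt (hxy.trans_lt hβ)
      · intro h x hx
        obtain ⟨y, hy, hlt⟩ := exists_pathEta_lt (b := b) hx
        have hxy : (pathEta n x y : Ordinal.{0}) < α := by
          rcases lt_max_iff.1 hlt with h' | h'
          · exact lt_of_lt_of_le (by exact_mod_cast h') h
          · rw [Nat.lt_one_iff.1 h', Nat.cast_zero]
            exact pos_iff_ne_zero.2 hα
        exact ⟨y, hy, _, hxy, (ih _ hxy x y).2 le_rfl⟩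

theorem etaPair_pathGraph {n : ℕ} (a b : Fin n) :
    etaPair (SimpleGraph.pathGraph n) a b = (pathEta n a b : Ordinal.{0}) := by
  simp only [etaPair, crRel_pathGraph_iff]
  exact csInf_Ici

theorem etaVert_pathGraph {n : ℕ} (b : Fin n) :
    etaVert (SimpleGraph.pathGraph n) b = ((max b.val (n - 1 - b) : ℕ) : Ordinal.{0}) := by
  simp only [etaVert, etaPair_pathGraph]
  apply le_antisymm
  · refine Ordinal.iSup_le fun a => ?_
    rw [Nat.cast_le, pathEta]
    split_ifs <;> omega
  · obtain ⟨a, ha⟩ : ∃ a, max b.val (n - 1 - b) ≤ pathEta n a b := by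
      simp only [pathEta, Fin.ext_iff, Fin.lt_def]
      by_cases hb : b.val ≤ n - 1 - b
      · exact ⟨⟨n - 1, by omega⟩, by simp only; split_ifs <;> omega⟩
      · exact ⟨⟨0, by omega⟩, by simp only; split_ifs <;> omega⟩
    exact (Nat.cast_le.2 ha).trans
      (Ordinal.le_iSup (fun a => (pathEta n a b : Ordinal.{0})) a)

theorem etaG_pathGraph {n : ℕ} (hn : 1 ≤ n) :
    etaG (SimpleGraph.pathGraph n) = ((n / 2 : ℕ) : Ordinal.{0}) := by
  have : Nonempty (Fin n) := ⟨⟨0, hn⟩⟩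
  simp only [etaG, etaVert_pathGraph]
  apply le_antisymm
  · refine (ciInf_le' _ (⟨n / 2, by omega⟩ : Fin n)).trans ?_
    rw [Nat.cast_le]
    simp only
    omega
  · refine le_ciInf fun b => ?_
    rw [Nat.cast_le]
    omega

theorem CRord_pathGraph {n : ℕ} (hn : 1 ≤ n) :
    CRord (SimpleGraph.pathGraph n) = ((n - 1 : ℕ) : Ordinal.{0}) := by
  have hle (a b : Fin n) : (pathEta n a b : Ordinal.{0}) ≤ ((n - 1 : ℕ) : Ordinal.{0}) := by
    rw [Nat.cast_le, pathEta]
    split_ifs <;> omega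
  rw [CRord]
  apply le_antisymm
  · refine csInf_le' ?_
    ext a b
    simp only [crRel_pathGraph_iff]
    exact iff_of_true (hle a b) ((hle a b).trans le_self_add)
  · refine le_csInf ⟨((n - 1 : ℕ) : Ordinal.{0}), ?_⟩ fun α hα => ?_
    · ext a b
      simp only [crRel_pathGraph_iff]
      exact iff_of_true (hle a b) ((hle a b).trans le_self_add)
    · by_contra! hlt
      obtain ⟨k, rfl⟩ := Ordinal.lt_omega0.1 (hlt.trans (Ordinal.natCast_lt_omega0 _))
      rw [Nat.cast_lt] at hlt
      have h := congrFun (congrFun hα ⟨0, hn⟩) ⟨k + 1, by omega⟩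
      rw [eq_iff_iff, crRel_pathGraph_iff, crRel_pathGraph_iff] at h
      have hk : pathEta n ⟨0, hn⟩ ⟨k + 1, by omega⟩ = k + 1 := by simp [pathEta]
      rw [hk, Nat.cast_add, Nat.cast_one] at h
      have := h.2 le_rfl
      norm_cast at this
      omega

/-- For `n ≥ 2`, the path `P_n` on `n` vertices has `η(P_n) = ⌈(n-1)/2⌉` and
`ρ(P_n) = n - 1`; in particular every finite ordinal is the CR-ordinal of a finite path. -/
theorem eta_crOrd_pathGraph :
    (∀ n : ℕ, 2 ≤ n →
      etaG (SimpleGraph.pathGraph n) = (((n - 1 + 1) / 2 : ℕ) : Ordinal.{0}) ∧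
      CRord (SimpleGraph.pathGraph n) = ((n - 1 : ℕ) : Ordinal.{0})) ∧
    ∀ m : ℕ, ∃ n : ℕ, 1 ≤ n ∧ CRord (SimpleGraph.pathGraph n) = (m : Ordinal.{0}) := by
  refine ⟨fun n hn => ⟨?_, CRord_pathGraph (by omega)⟩, fun m => ⟨m + 1, by omega, ?_⟩⟩
  · rw [etaG_pathGraph (by omega), Nat.sub_add_cancel (by omega)]
  · rw [CRord_pathGraph (by omega), Nat.add_sub_cancel]
end
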